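/- arXiv:1802.00703 — 2 statements merged into one kernel-verified Lean document; each statement's English description precedes it below -/
import Mathlib

section
/- Among all binary strings x of length m ≥ 2, the constant strings x = 0^m and x = 1^m maximize, and the alternating strings x = 0101... and x = 1010... minimize, the number of supersequences y ∈ {0,1}^n with ω_x(y) = 1, for every n > m. -/
/-- The number of adjacent pairs of equal letters in `a :: l`. -/
def adjacentRepeats : Bool → List Bool → ℕ
  | _, [] => 0
  | a, c :: l => (if a = c then 1 else 0) + adjacentRepeats c l

lemma adjacentRepeats_le_length (a : Bool) (l : List Bool) :
    adjacentRepeats a l ≤ l.length := by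
  induction l generalizing a with
  | nil => simp [adjacentRepeats]
  | cons c l ih =>
    have := ih c
    simp only [adjacentRepeats, List.length_cons]
    split_ifs <;> omega

lemma adjacentRepeats_replicate (a : Bool) (k : ℕ) :
    adjacentRepeats a (List.replicate k a) = k := by
  induction k with
  | zero => rfl
  | succ k ih => simp [List.replicate_succ, adjacentRepeats, ih, add_comm]

lemma adjacentRepeats_ofFn {k : ℕ} (f : Fin (k + 1) → Bool)
    (hf : ∀ i : Fin k, f i.castSucc ≠ f i.succ) :
    adjacentRepeats (f 0) (List.ofFn fun i : Fin k => f i.succ) = 0 := by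
  induction k with
  | zero => simp [adjacentRepeats]
  | succ k ih =>
    rw [List.ofFn_succ, adjacentRepeats, if_neg (by exact hf 0), zero_add]
    exact ih (fun i => f i.succ) fun i => hf i.succ

namespace List

variable {α : Type*} [DecidableEq α]

lemma count_sublists_nil_right (y : List α) : y.sublists.count [] = 1 := by
  rw [(sublists_perm_sublists' y).count_eq]
  induction y with
  | nil => simp
  | cons b y ih =>
    rw [sublists'_cons, count_append, ih, count_eq_zero_of_not_mem (by simp)]

lemma count_sublists_cons_self (a : α) (x y : List α) :
    (a :: y).sublists.count (a :: x) = y.sublists.count (a :: x) + y.sublists.count x := by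
  simp only [(sublists_perm_sublists' _).count_eq, sublists'_cons, count_append]
  rw [count_map_of_injective _ _ (cons_injective (a := a))]

lemma count_sublists_cons_of_ne {a b : α} (h : b ≠ a) (x y : List α) :
    (b :: y).sublists.count (a :: x) = y.sublists.count (a :: x) := by
  simp only [(sublists_perm_sublists' _).count_eq, sublists'_cons, count_append]
  rw [Nat.add_eq_left]
  exact count_eq_zero_of_not_mem (by simp [h])

lemma count_sublists_eq_zero_iff {x y : List α} : y.sublists.count x = 0 ↔ ¬ x <+ y := by
  rw [count_eq_zero, mem_sublists]

lemma count_sublists_cons_eq_zero_of_eq_zero {x y : List α} (a : α)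
    (h : y.sublists.count x = 0) : y.sublists.count (a :: x) = 0 := by
  rw [count_sublists_eq_zero_iff] at h ⊢
  exact fun hs => h ((sublist_cons_self a x).trans hs)

lemma count_sublists_cons_self_eq_one_iff (a : α) (x y : List α) :
    (a :: y).sublists.count (a :: x) = 1 ↔
      y.sublists.count x = 1 ∧ y.sublists.count (a :: x) = 0 := by
  have := count_sublists_cons_eq_zero_of_eq_zero (x := x) (y := y) a
  rw [count_sublists_cons_self]
  omega

end List

/-- The number of binary strings of length `n` satisfying `P`. -/
noncomputable def numStrings (P : List Bool → Prop) (n : ℕ) : ℕ :=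
  Nat.card {y : List Bool // y.length = n ∧ P y}

lemma numStrings_congr {P Q : List Bool → Prop} (h : ∀ y, P y ↔ Q y) (n : ℕ) :
    numStrings P n = numStrings Q n := by
  rw [funext fun y => propext (h y)]

lemma numStrings_eq_zero {P : List Bool → Prop} {n : ℕ} (h : ∀ y, y.length = n → ¬ P y) :
    numStrings P n = 0 := by
  have : IsEmpty {y : List Bool // y.length = n ∧ P y} := ⟨fun y => h y.1 y.2.1 y.2.2⟩
  exact Nat.card_of_isEmpty

lemma numStrings_zero {P : List Bool → Prop} (h : P []) : numStrings P 0 = 1 := by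
  rw [numStrings, Nat.card_eq_one_iff_unique]
  exact ⟨⟨fun y z => Subtype.ext <| (List.length_eq_zero_iff.1 y.2.1).trans
    (List.length_eq_zero_iff.1 z.2.1).symm⟩, ⟨⟨[], rfl, h⟩⟩⟩

/-- Splitting strings according to whether the first letter is `a`. -/
lemma numStrings_succ (P : List Bool → Prop) (a : Bool) (n : ℕ) :
    numStrings P (n + 1) =
      numStrings (fun y => P ((!a) :: y)) n + numStrings (fun y => P (a :: y)) n := by
  have hfin (Q : List Bool → Prop) : Finite {y : List Bool // y.length = n ∧ Q y} :=
    ((List.finite_length_eq Bool n).subset fun _ hy => hy.1).to_subtype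
  have := hfin fun y => P ((!a) :: y)
  have := hfin fun y => P (a :: y)
  unfold numStrings
  rw [← Nat.card_sum]
  refine (Nat.card_eq_of_bijective
    (Sum.elim
      (fun y => ⟨(!a) :: y.1, by simp [y.2.1], y.2.2⟩)
      (fun y => ⟨a :: y.1, by simp [y.2.1], y.2.2⟩)) ⟨?_, ?_⟩).symm
  · rintro (⟨y, hy⟩ | ⟨y, hy⟩) (⟨z, hz⟩ | ⟨z, hz⟩) h <;> simp_all
  · rintro ⟨_ | ⟨b, y⟩, hlen, hP⟩
    · simp at hlen
    · by_cases hb : b = a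
      · subst hb
        exact ⟨.inr ⟨y, by simpa using hlen, hP⟩, rfl⟩
      · obtain rfl : b = !a := Bool.eq_not_of_ne hb
        exact ⟨.inl ⟨y, by simpa using hlen, hP⟩, rfl⟩

/-- `y` contains `x` exactly once and does not contain `a :: x`; equivalently, `a :: y` contains
`a :: x` exactly once. -/
def IsSingletonTail (a : Bool) (x y : List Bool) : Prop :=
  y.sublists.count x = 1 ∧ y.sublists.count (a :: x) = 0

lemma isSingletonTail_not_cons_nil (a : Bool) (y : List Bool) :
    IsSingletonTail a [] ((!a) :: y) ↔ IsSingletonTail a [] y := by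
  simp only [IsSingletonTail, List.count_sublists_nil_right,
    List.count_sublists_cons_of_ne (Bool.not_ne_self a)]

lemma not_isSingletonTail_cons_nil (a : Bool) (y : List Bool) :
    ¬ IsSingletonTail a [] (a :: y) := by
  simp [IsSingletonTail, List.count_sublists_nil_right, List.count_sublists_cons_self]

lemma isSingletonTail_not_cons_self (a : Bool) (x y : List Bool) :
    IsSingletonTail a (a :: x) ((!a) :: y) ↔ IsSingletonTail a (a :: x) y := by
  simp only [IsSingletonTail, List.count_sublists_cons_of_ne (Bool.not_ne_self a)]

lemma isSingletonTail_cons_self (a : Bool) (x y : List Bool) :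
    IsSingletonTail a (a :: x) (a :: y) ↔ IsSingletonTail a x y := by
  have := List.count_sublists_cons_eq_zero_of_eq_zero (x := a :: x) (y := y) a
  rw [IsSingletonTail, List.count_sublists_cons_self_eq_one_iff, List.count_sublists_cons_self,
    IsSingletonTail]
  omega

lemma not_isSingletonTail_cons_not (a : Bool) (x y : List Bool) :
    ¬ IsSingletonTail a ((!a) :: x) (a :: y) := by
  rw [IsSingletonTail, List.count_sublists_cons_self,
    List.count_sublists_cons_of_ne (Bool.not_ne_self a).symm]
  omega

lemma isSingletonTail_not_cons_not (a : Bool) (x y : List Bool) :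
    IsSingletonTail a ((!a) :: x) ((!a) :: y) ↔ IsSingletonTail (!a) x y := by
  have := List.count_sublists_cons_eq_zero_of_eq_zero (x := (!a) :: x) (y := y) a
  rw [IsSingletonTail, List.count_sublists_cons_self_eq_one_iff,
    List.count_sublists_cons_of_ne (Bool.not_ne_self a), IsSingletonTail]
  omega

lemma numStrings_eq_zero_of_lt {P : List Bool → Prop} {x : List Bool} {n : ℕ}
    (hP : ∀ y, P y → y.sublists.count x = 1) (hn : n < x.length) : numStrings P n = 0 := by
  refine numStrings_eq_zero fun y hy h => ?_
  have hpos : x ∈ y.sublists := List.count_pos_iff.1 (by rw [hP y h]; exact one_pos)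
  have := (List.mem_sublists.1 hpos).length_le
  omega

lemma numStrings_isSingletonTail (a : Bool) (x : List Bool) (d : ℕ) :
    numStrings (IsSingletonTail a x) (x.length + d) =
      (d + adjacentRepeats a x).choose (adjacentRepeats a x) := by
  induction x generalizing a d with
  | nil =>
    simp only [List.length_nil, zero_add, adjacentRepeats, Nat.choose_zero_right]
    induction d with
    | zero => exact numStrings_zero (by simp [IsSingletonTail])
    | succ d ih =>
      rw [numStrings_succ _ a, numStrings_congr (isSingletonTail_not_cons_nil a), ih,
        numStrings_eq_zero fun y _ => not_isSingletonTail_cons_nil a y]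
  | cons c x ih =>
    by_cases hc : c = a
    · subst hc
      have hstep (n : ℕ) : numStrings (IsSingletonTail c (c :: x)) (n + 1) =
          numStrings (IsSingletonTail c (c :: x)) n + numStrings (IsSingletonTail c x) n := by
        rw [numStrings_succ _ c, numStrings_congr (isSingletonTail_not_cons_self c x),
          numStrings_congr (isSingletonTail_cons_self c x)]
      simp only [adjacentRepeats, if_true, List.length_cons]
      induction d with
      | zero =>
        rw [add_zero, hstep, numStrings_eq_zero_of_lt (x := c :: x) (fun y h => h.1) (by simp)]
        simpa using ih c 0
      | succ d ihd =>
        rw [← add_assoc, hstep, ihd, show x.length + 1 + d = x.length + (d + 1) by omega, ih,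
          show d + 1 + (1 + adjacentRepeats c x) = d + 1 + adjacentRepeats c x + 1 by omega,
          add_comm 1 (adjacentRepeats c x), Nat.choose_succ_succ, add_comm,
          show d + (adjacentRepeats c x + 1) = d + 1 + adjacentRepeats c x by omega]
    · obtain rfl : c = !a := Bool.eq_not_of_ne hc
      rw [List.length_cons, add_right_comm, numStrings_succ _ a,
        numStrings_congr (isSingletonTail_not_cons_not a x), ih,
        numStrings_eq_zero fun y _ => not_isSingletonTail_cons_not a x y]
      simp [adjacentRepeats]

/-- The number of singletons of `a :: x` depends only on its number of adjacent repeats. -/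
lemma numStrings_count_sublists_eq_one (a : Bool) (x : List Bool) (d : ℕ) :
    numStrings (fun y => y.sublists.count (a :: x) = 1) (x.length + 1 + d) =
      (d + adjacentRepeats a x + 1).choose (adjacentRepeats a x + 1) := by
  have hstep (n : ℕ) : numStrings (fun y => y.sublists.count (a :: x) = 1) (n + 1) =
      numStrings (fun y => y.sublists.count (a :: x) = 1) n +
        numStrings (IsSingletonTail a x) n := by
    rw [numStrings_succ _ a]
    congr 1
    · exact numStrings_congr
        (fun y => by rw [List.count_sublists_cons_of_ne (Bool.not_ne_self a)]) n
    · exact numStrings_congr (List.count_sublists_cons_self_eq_one_iff a x) n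
  induction d with
  | zero =>
    rw [add_zero, hstep, numStrings_eq_zero_of_lt (x := a :: x) (fun y h => h) (by simp)]
    simpa using numStrings_isSingletonTail a x 0
  | succ d ih =>
    rw [← add_assoc, hstep, ih, show x.length + 1 + d = x.length + (d + 1) by omega,
      numStrings_isSingletonTail, add_right_comm d 1, add_comm]
    exact (Nat.choose_succ_succ _ _).symm

/-- More adjacent repeats give at least as many singletons. -/
lemma card_singletons_le_of_adjacentRepeats_le {a b : Bool} {x z : List Bool} {n : ℕ}
    (hlen : x.length = z.length) (hn : x.length < n)
    (h : adjacentRepeats a x ≤ adjacentRepeats b z) :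
    Nat.card {y : List Bool // y.length = n ∧ y.sublists.count (a :: x) = 1} ≤
      Nat.card {y : List Bool // y.length = n ∧ y.sublists.count (b :: z) = 1} := by
  obtain ⟨d, rfl⟩ := Nat.exists_eq_add_of_le (Nat.succ_le_of_lt hn)
  have hx := numStrings_count_sublists_eq_one a x d
  have hz := numStrings_count_sublists_eq_one b z d
  rw [← hlen] at hz
  rw [add_assoc d, ← Nat.choose_symm_add] at hx hz
  exact hx.trans_le ((Nat.choose_le_choose d (by omega)).trans_eq hz.symm)

/-- Among binary strings `x` of length `m ≥ 2`, the constant strings maximize and the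
alternating strings minimize the number of supersequences `y` of length `n > m`
admitting exactly one embedding of `x` (singletons). -/
theorem singleton_extremizers (m n : ℕ) (hm : 2 ≤ m) (hn : m < n)
    (x : List Bool) (hx : x.length = m) :
    (Nat.card {y : List Bool // y.length = n ∧
        y.sublists.count (List.ofFn fun i : Fin m => decide (i.1 % 2 = 1)) = 1} ≤
      Nat.card {y : List Bool // y.length = n ∧ y.sublists.count x = 1}) ∧
    (Nat.card {y : List Bool // y.length = n ∧
        y.sublists.count (List.ofFn fun i : Fin m => decide (i.1 % 2 = 0)) = 1} ≤
      Nat.card {y : List Bool // y.length = n ∧ y.sublists.count x = 1}) ∧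
    (Nat.card {y : List Bool // y.length = n ∧ y.sublists.count x = 1} ≤
      Nat.card {y : List Bool // y.length = n ∧
        y.sublists.count (List.replicate m false) = 1}) ∧
    (Nat.card {y : List Bool // y.length = n ∧ y.sublists.count x = 1} ≤
      Nat.card {y : List Bool // y.length = n ∧
        y.sublists.count (List.replicate m true) = 1}) := by
  obtain ⟨k, rfl⟩ : ∃ k, m = k + 1 := ⟨m - 1, by omega⟩
  obtain _ | ⟨a, x⟩ := x
  · simp at hx
  replace hx : x.length = k := by simpa using hx
  have halt (f : Fin (k + 1) → Bool) (hf : ∀ i : Fin k, f i.castSucc ≠ f i.succ) :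
      Nat.card {y : List Bool // y.length = n ∧ y.sublists.count (List.ofFn f) = 1} ≤
        Nat.card {y : List Bool // y.length = n ∧ y.sublists.count (a :: x) = 1} := by
    rw [List.ofFn_succ]
    refine card_singletons_le_of_adjacentRepeats_le (by simp [hx]) (by simp; omega) ?_
    rw [adjacentRepeats_ofFn f hf]
    exact Nat.zero_le _
  have hconst (b : Bool) :
      Nat.card {y : List Bool // y.length = n ∧ y.sublists.count (a :: x) = 1} ≤
        Nat.card {y : List Bool // y.length = n ∧
          y.sublists.count (List.replicate (k + 1) b) = 1} := by
    rw [List.replicate_succ]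
    refine card_singletons_le_of_adjacentRepeats_le (by simp [hx]) (by omega) ?_
    rw [adjacentRepeats_replicate, ← hx]
    exact adjacentRepeats_le_length a x
  refine ⟨halt _ fun i => ?_, halt _ fun i => ?_, hconst false, hconst true⟩ <;>
  · rw [Ne, decide_eq_decide, Fin.val_castSucc, Fin.val_succ]
    omega
end

section
/- For every n ≥ 3 and every binary string x of length m = n − 2, the Shannon entropy H_n(x) of the normalized weight distribution P_x satisfies H_n(x) ≥ H_n(0^m), with equality only if x ∈ {0^m, 1^m}. -/
open scoped BigOperators

/-- The number of embeddings (masks) of `x` in `y`. -/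
def wt (x y : List Bool) : ℕ := y.sublists.count x

/-- The Shannon entropy (base 2) of the normalized weight distribution `P_x` over
supersequences `y ∈ {0,1}^n` of `x`, with total weight `μ = C(n,m)·2^{n-m}`. -/
noncomputable def Hent (n : ℕ) (x : List Bool) : ℝ :=
  -∑ y : Fin n → Bool,
    ((wt x (List.ofFn y) : ℝ) / ((n.choose x.length * 2 ^ (n - x.length) : ℕ) : ℝ)) *
      Real.logb 2
        ((wt x (List.ofFn y) : ℝ) / ((n.choose x.length * 2 ^ (n - x.length) : ℕ) : ℝ))

lemma wt_nil (y : List Bool) : wt [] y = 1 := by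
  unfold wt
  rw [(List.sublists_perm_sublists' y).count_eq]
  induction y with
  | nil => rfl
  | cons b y ih =>
    rw [List.sublists'_cons, List.count_append, ih, List.count_eq_zero_of_not_mem (by simp)]

lemma wt_cons_nil (a : Bool) (x : List Bool) : wt (a :: x) [] = 0 := by
  simp [wt]

lemma wt_cons_cons_self (a : Bool) (x y : List Bool) :
    wt (a :: x) (a :: y) = wt x y + wt (a :: x) y := by
  unfold wt
  simp only [(List.sublists_perm_sublists' _).count_eq, List.sublists'_cons, List.count_append]
  rw [List.count_map_of_injective _ _ List.cons_injective, add_comm]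

lemma wt_cons_cons_not (a : Bool) (x y : List Bool) :
    wt (a :: x) ((!a) :: y) = wt (a :: x) y := by
  unfold wt
  simp only [(List.sublists_perm_sublists' _).count_eq, List.sublists'_cons, List.count_append]
  rw [Nat.add_eq_left]
  exact List.count_eq_zero_of_not_mem (by simp)

lemma wt_pos_iff (x y : List Bool) : 0 < wt x y ↔ x.Sublist y := by
  simp [wt, List.count_pos_iff]

/-- The number of embeddings of `x` in `y` is at most the number of position sets. -/
lemma wt_le_choose (x y : List Bool) : wt x y ≤ y.length.choose x.length := by
  induction y generalizing x with
  | nil => cases x <;> simp [wt_nil, wt_cons_nil]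
  | cons b y ih =>
    cases x with
    | nil => simp [wt_nil]
    | cons a x =>
      have h₁ := ih x
      have h₂ := ih (a :: x)
      simp only [List.length_cons] at *
      rw [Nat.choose_succ_succ']
      by_cases hab : b = a
      · subst hab
        rw [wt_cons_cons_self]
        exact add_le_add h₁ h₂
      · obtain rfl : b = !a := by cases a <;> cases b <;> simp_all
        rw [wt_cons_cons_not]
        omega

lemma wt_replicate (a : Bool) (m : ℕ) (y : List Bool) :
    wt (List.replicate m a) y = (y.count a).choose m := by
  induction y generalizing m with
  | nil => cases m <;> simp [wt_nil, wt_cons_nil, List.replicate_succ]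
  | cons b y ih =>
    cases m with
    | zero => simp [wt_nil]
    | succ m =>
      by_cases hab : b = a
      · subst hab
        rw [List.replicate_succ, wt_cons_cons_self, ← List.replicate_succ, ih, ih,
          List.count_cons_self, Nat.choose_succ_succ]
      · obtain rfl : b = !a := by cases a <;> cases b <;> simp_all
        rw [List.replicate_succ, wt_cons_cons_not, ← List.replicate_succ, ih]
        simp

/-- Splitting a sum over binary strings according to whether the first letter is `a`. -/
lemma sum_ofFn_succ {M : Type*} [AddCommMonoid M] (a : Bool) (n : ℕ) (f : List Bool → M) :
    ∑ y : Fin (n + 1) → Bool, f (List.ofFn y) =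
      (∑ y : Fin n → Bool, f (a :: List.ofFn y)) + ∑ y : Fin n → Bool, f ((!a) :: List.ofFn y) := by
  rw [← (Fin.consEquiv fun _ => Bool).sum_comp, Fintype.sum_prod_type, Fintype.sum_bool]
  cases a
  · rw [add_comm]
    simp [Fin.consEquiv, List.ofFn_succ]
  · simp [Fin.consEquiv, List.ofFn_succ]

lemma sum_wt (n : ℕ) (x : List Bool) :
    (∑ y : Fin n → Bool, wt x (List.ofFn y)) * 2 ^ x.length = n.choose x.length * 2 ^ n := by
  induction n generalizing x with
  | zero => cases x <;> simp [wt_nil, wt_cons_nil]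
  | succ n ih =>
    cases x with
    | nil => simp [wt_nil]
    | cons a x =>
      have h₁ := ih x
      have h₂ := ih (a :: x)
      rw [sum_ofFn_succ a]
      simp only [wt_cons_cons_self, wt_cons_cons_not, Finset.sum_add_distrib, List.length_cons,
        Nat.choose_succ_succ, pow_succ] at *
      linear_combination 2 * h₁ + 2 * h₂

/-- The number of supersequences of length `n` depends only on `n` and the length of `x`. -/
lemma sum_min_wt (n : ℕ) (x : List Bool) :
    ∑ y : Fin n → Bool, min 1 (wt x (List.ofFn y)) =
      ∑ i ∈ Finset.range (n + 1 - x.length), n.choose i := by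
  induction n generalizing x with
  | zero => cases x <;> simp [wt_nil, wt_cons_nil]
  | succ n ih =>
    cases x with
    | nil => simp [wt_nil, Nat.sum_range_choose]
    | cons a x =>
      have hgreedy (y : List Bool) : min 1 (wt (a :: x) (a :: y)) = min 1 (wt x y) := by
        have h : wt x y = 0 → wt (a :: x) y = 0 := by
          intro h
          by_contra h'
          have := (wt_pos_iff _ _).2
            ((List.sublist_cons_self a x).trans ((wt_pos_iff _ _).1 (Nat.pos_of_ne_zero h')))
          omega
        rw [wt_cons_cons_self]
        omega
      rw [sum_ofFn_succ a n fun y => min 1 (wt (a :: x) y)]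
      simp only [hgreedy, wt_cons_cons_not, ih, List.length_cons]
      simp only [Nat.add_sub_add_right]
      obtain h | h := le_or_gt (n + 1) x.length
      · simp [Nat.sub_eq_zero_of_le h, Nat.sub_eq_zero_of_le (Nat.le_of_succ_le h)]
      · obtain ⟨k, hk⟩ : ∃ k, n + 1 - x.length = k + 1 := ⟨n - x.length, by omega⟩
        rw [hk, show n - x.length = k by omega, Finset.sum_range_succ' _ k,
          Finset.sum_range_succ' _ k]
        simp only [Nat.choose_succ_succ, Finset.sum_add_distrib, Nat.choose_zero_right]
        ring

lemma choose_add_two_two (k : ℕ) : (k + 2).choose 2 = (k + 1) + (k + 1).choose 2 := by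
  rw [Nat.choose_succ_succ' (k + 1), Nat.choose_one_right]

/-- The truncated excess `∑ (ω_x(y) - t)₊` over strings `y` of length `n`. -/
def excess (t n : ℕ) (x : List Bool) : ℕ :=
  ∑ y : Fin n → Bool, (wt x (List.ofFn y) - t)

lemma excess_one_add (n : ℕ) (x : List Bool) :
    excess 1 n x + ∑ y : Fin n → Bool, min 1 (wt x (List.ofFn y)) =
      ∑ y : Fin n → Bool, wt x (List.ofFn y) := by
  rw [excess, ← Finset.sum_add_distrib]
  exact Finset.sum_congr rfl fun y _ => by omega

lemma sum_wt_eq_of_length_eq (n : ℕ) {x x' : List Bool} (h : x.length = x'.length) :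
    ∑ y : Fin n → Bool, wt x (List.ofFn y) = ∑ y : Fin n → Bool, wt x' (List.ofFn y) := by
  refine Nat.eq_of_mul_eq_mul_right (pow_pos two_pos x.length) ?_
  rw [sum_wt, h, sum_wt]

lemma excess_one_eq_of_length_eq (n : ℕ) {x x' : List Bool} (h : x.length = x'.length) :
    excess 1 n x = excess 1 n x' := by
  have h₁ := excess_one_add n x
  have h₂ := excess_one_add n x'
  rw [sum_min_wt] at h₁ h₂
  rw [sum_wt_eq_of_length_eq n h, h] at h₁
  omega

lemma excess_one_single_deletion (x : List Bool) : excess 1 (x.length + 1) x = x.length := by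
  have h₁ := excess_one_add (x.length + 1) x
  have h₂ : ∑ y : Fin (x.length + 1) → Bool, wt x (List.ofFn y) = 2 * (x.length + 1) := by
    refine Nat.eq_of_mul_eq_mul_right (pow_pos two_pos x.length) ?_
    rw [sum_wt, Nat.choose_succ_self_right]
    ring
  rw [sum_min_wt, h₂, show x.length + 1 + 1 - x.length = 2 by omega] at h₁
  simp [Finset.sum_range_succ] at h₁
  omega

/-- Only strings `y` starting with the first letter of `a :: x` contribute to its excess. -/
lemma excess_cons (a : Bool) (x : List Bool) :
    excess (x.length + 2) (x.length + 3) (a :: x) =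
      ∑ y : Fin (x.length + 2) → Bool,
        (wt x (List.ofFn y) + wt (a :: x) (List.ofFn y) - (x.length + 2)) := by
  rw [excess, sum_ofFn_succ a _ fun y => wt (a :: x) y - (x.length + 2), Nat.add_eq_left.2]
  · simp only [wt_cons_cons_self]
  · refine Finset.sum_eq_zero fun y _ => ?_
    have := wt_le_choose (a :: x) (List.ofFn y)
    rw [List.length_ofFn, List.length_cons, Nat.choose_succ_self_right] at this
    rw [wt_cons_cons_not]
    omega

lemma sum_excess_add_excess (a : Bool) (x : List Bool) :
    ∑ y : Fin (x.length + 2) → Bool,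
        ((wt x (List.ofFn y) - (x.length + 1)) + (wt (a :: x) (List.ofFn y) - 1)) =
      excess (x.length + 1) (x.length + 2) x + (x.length + 1) := by
  rw [Finset.sum_add_distrib]
  exact congrArg₂ _ rfl (excess_one_single_deletion (a :: x))

lemma excess_cons_le (a : Bool) (x : List Bool) :
    excess (x.length + 2) (x.length + 3) (a :: x) ≤
      excess (x.length + 1) (x.length + 2) x + (x.length + 1) := by
  rw [excess_cons, ← sum_excess_add_excess a]
  exact Finset.sum_le_sum fun y _ => by omega

lemma excess_le (x : List Bool) :
    excess (x.length + 1) (x.length + 2) x ≤ (x.length + 1).choose 2 := by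
  induction x with
  | nil => simp [excess, wt_nil]
  | cons a x ih =>
    have h := excess_cons_le a x
    change excess (x.length + 2) (x.length + 3) (a :: x) ≤ (x.length + 2).choose 2
    rw [choose_add_two_two]
    omega

/-- A string that is constant after its first letter, which differs, has smaller excess. -/
lemma excess_cons_replicate_lt (a : Bool) (k : ℕ) :
    excess (k + 3) (k + 4) (a :: List.replicate (k + 1) (!a)) <
      excess (k + 2) (k + 3) (List.replicate (k + 1) (!a)) + (k + 2) := by
  have h₁ := excess_cons a (List.replicate (k + 1) (!a))
  have h₂ := sum_excess_add_excess a (List.replicate (k + 1) (!a))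
  rw [List.length_replicate] at h₁ h₂
  rw [h₁, ← h₂]
  refine Finset.sum_lt_sum (fun y _ => by omega)
    ⟨Fin.cons a (Fin.cons a fun _ => !a), Finset.mem_univ _, ?_⟩
  have hy : List.ofFn (Fin.cons a (Fin.cons a fun _ => !a) : Fin (k + 3) → Bool) =
      a :: a :: List.replicate (k + 1) (!a) := by
    simp [List.ofFn_succ, List.replicate_succ]
  have hx : wt (List.replicate (k + 1) (!a)) (a :: a :: List.replicate (k + 1) (!a)) = 1 := by
    simp [wt_replicate]
  have hx' : 0 < wt (a :: List.replicate (k + 1) (!a)) (a :: List.replicate (k + 1) (!a)) :=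
    (wt_pos_iff _ _).2 (List.Sublist.refl _)
  have hx'' : wt (a :: List.replicate (k + 1) (!a)) (a :: a :: List.replicate (k + 1) (!a)) =
      wt (List.replicate (k + 1) (!a)) (a :: List.replicate (k + 1) (!a)) +
        wt (a :: List.replicate (k + 1) (!a)) (a :: List.replicate (k + 1) (!a)) :=
    wt_cons_cons_self _ _ _
  have h₃ : wt (List.replicate (k + 1) (!a)) (a :: List.replicate (k + 1) (!a)) = 1 := by
    simp [wt_replicate]
  rw [hy]
  omega

lemma excess_lt (x : List Bool) (hx : ∀ a, x ≠ List.replicate x.length a) :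
    excess (x.length + 1) (x.length + 2) x < (x.length + 1).choose 2 := by
  induction x with
  | nil => exact absurd rfl (hx true)
  | cons a x ih =>
    change excess (x.length + 2) (x.length + 3) (a :: x) < (x.length + 2).choose 2
    rw [choose_add_two_two]
    by_cases h : ∀ b, x ≠ List.replicate x.length b
    · have := excess_cons_le a x
      have := ih h
      omega
    · push Not at h
      obtain ⟨b, hb⟩ := h
      have hb' : x.length ≠ 0 := by
        intro h0
        rw [List.length_eq_zero_iff] at h0
        exact hx a (by simp [h0])
      obtain ⟨k, hk⟩ := Nat.exists_eq_add_one_of_ne_zero hb'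
      have hba : b = !a := by
        by_contra hne
        obtain rfl : b = a := by revert hne; cases a <;> cases b <;> decide
        exact hx b (by rw [List.length_cons, List.replicate_succ, ← hb])
      subst hba
      have h₁ := excess_cons_replicate_lt a k
      have h₂ := excess_le x
      rw [← hk, ← hb, show k + 2 = x.length + 1 by omega, show k + 3 = x.length + 2 by omega,
        show k + 4 = x.length + 3 by omega] at h₁
      omega

lemma choose_le_excess_replicate (m : ℕ) :
    (m + 1).choose 2 ≤ excess (m + 1) (m + 2) (List.replicate m false) := by
  have h := Finset.single_le_sum
    (f := fun y : Fin (m + 2) → Bool => wt (List.replicate m false) (List.ofFn y) - (m + 1))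
    (fun _ _ => Nat.zero_le _) (Finset.mem_univ fun _ => false)
  refine le_trans ?_ h
  have : (m + 2).choose m = (m + 1) + (m + 1).choose 2 := by
    rw [Nat.choose_symm_of_eq_add rfl, choose_add_two_two]
  simp [wt_replicate, List.ofFn_const, this]

/-- Slopes of the piecewise linear interpolation of `w * log w` at `1 < K < M`. -/
lemma exists_interpolation {K M : ℕ} (hK : 1 < K) (hM : K < M) :
    ∃ b c : ℝ, 0 < c ∧
      (∀ w : ℕ, w ≤ M → (w : ℝ) * Real.log w ≤ b * (w - 1 : ℕ) + c * (w - K : ℕ)) ∧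
      ∀ w : ℕ, w = 0 ∨ w = 1 ∨ w = K ∨ w = M →
        (w : ℝ) * Real.log w = b * (w - 1 : ℕ) + c * (w - K : ℕ) := by
  have hK' : (1 : ℝ) < K := by exact_mod_cast hK
  have hM' : (K : ℝ) < M := by exact_mod_cast hM
  set φ : ℝ → ℝ := fun w => w * Real.log w with hφ
  have hconv : StrictConvexOn ℝ (Set.Ici 0) φ := Real.strictConvexOn_mul_log
  have hφ1 : φ 1 = 0 := by simp [hφ]
  set b := φ K / (K - 1) with hb
  set d := (φ M - φ K) / (M - K) with hd
  have hbK : b * (K - 1) = φ K := div_mul_cancel₀ _ (by linarith)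
  have hdM : d * (M - K) = φ M - φ K := div_mul_cancel₀ _ (by linarith)
  refine ⟨b, d - b, ?_, ?_, ?_⟩
  · have := hconv.slope_strict_mono_adjacent (x := 1) (y := K) (z := M)
      (by simp) (by simp) hK' hM'
    rw [hφ1, sub_zero] at this
    exact sub_pos.2 this
  · intro w hw
    obtain rfl | hw0 := Nat.eq_zero_or_pos w
    · simp
    have hw1 : (1 : ℝ) ≤ w := by exact_mod_cast hw0
    change φ w ≤ _
    rw [Nat.cast_sub hw0, Nat.cast_one]
    obtain h | h := le_total w K
    · rw [Nat.sub_eq_zero_of_le h, Nat.cast_zero, mul_zero, add_zero]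
      obtain rfl | hlt := h.eq_or_lt
      · exact hbK.ge
      obtain rfl | hw1' := (Nat.succ_le_of_lt hw0).eq_or_lt
      · simp [hφ]
      have := hconv.secant_strict_mono (a := 1) (x := w) (y := K) (by simp) (by simp) (by simp)
        (by exact_mod_cast hw1'.ne') hK'.ne' (by exact_mod_cast hlt)
      rw [hφ1, sub_zero, sub_zero,
        div_lt_iff₀ (sub_pos.2 (by exact_mod_cast hw1'))] at this
      exact this.le
    · rw [Nat.cast_sub h]
      obtain rfl | hlt := h.eq_or_lt
      · simp [hbK]
      obtain rfl | hwM := hw.eq_or_lt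
      · linarith
      have hlt' : (K : ℝ) < w := by exact_mod_cast hlt
      have := hconv.secant_strict_mono (a := K) (x := w) (y := M) (by simp) (by simp) (by simp)
        hlt'.ne' hM'.ne' (by exact_mod_cast hwM)
      rw [div_lt_iff₀ (by linarith)] at this
      linarith
  · rintro w (rfl | rfl | rfl | rfl)
    · simp
    · simp [Nat.sub_eq_zero_of_le hK.le]
    · rw [Nat.sub_self, Nat.cast_sub hK.le, Nat.cast_one]
      simpa using hbK.symm
    · rw [Nat.cast_sub hM.le, Nat.cast_sub (hK.trans hM).le, Nat.cast_one]
      change φ w = _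
      linarith

/-- The entropy as an affine function of `∑ ω log ω`. -/
lemma Hent_eq (n : ℕ) (x : List Bool) (hx : x.length ≤ n) :
    Hent n x = ((∑ y : Fin n → Bool, wt x (List.ofFn y) : ℕ) *
        Real.log (n.choose x.length * 2 ^ (n - x.length) : ℕ) -
      ∑ y : Fin n → Bool, (wt x (List.ofFn y) : ℝ) * Real.log (wt x (List.ofFn y))) /
        ((n.choose x.length * 2 ^ (n - x.length) : ℕ) * Real.log 2) := by
  have hμ : ((n.choose x.length * 2 ^ (n - x.length) : ℕ) : ℝ) ≠ 0 :=
    Nat.cast_ne_zero.2 (mul_pos (Nat.choose_pos hx) (by positivity)).ne'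
  have hlog : Real.log 2 ≠ 0 := (Real.log_pos one_lt_two).ne'
  unfold Hent
  set μ : ℝ := ((n.choose x.length * 2 ^ (n - x.length) : ℕ) : ℝ)
  rw [Nat.cast_sum, Finset.sum_mul, ← Finset.sum_sub_distrib, Finset.sum_div,
    ← Finset.sum_neg_distrib]
  refine Finset.sum_congr rfl fun y _ => ?_
  obtain h | h := eq_or_ne (wt x (List.ofFn y)) 0
  · simp [h]
  · rw [Real.logb, Real.log_div (Nat.cast_ne_zero.2 h) hμ]
    field_simp
    ring

lemma sum_mul_log_le {m : ℕ} {b c : ℝ} (x : List Bool) (hx : x.length = m)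
    (h : ∀ w : ℕ, w ≤ (m + 2).choose 2 →
      (w : ℝ) * Real.log w ≤ b * (w - 1 : ℕ) + c * (w - (m + 1) : ℕ)) :
    ∑ y : Fin (m + 2) → Bool, (wt x (List.ofFn y) : ℝ) * Real.log (wt x (List.ofFn y)) ≤
      b * excess 1 (m + 2) x + c * excess (m + 1) (m + 2) x := by
  simp only [excess, Nat.cast_sum, Finset.mul_sum, ← Finset.sum_add_distrib]
  refine Finset.sum_le_sum fun y _ => h _ ?_
  have := wt_le_choose x (List.ofFn y)
  rwa [List.length_ofFn, hx, Nat.choose_symm_of_eq_add rfl] at this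

lemma sum_mul_log_replicate {m : ℕ} {b c : ℝ}
    (h : ∀ w : ℕ, w = 0 ∨ w = 1 ∨ w = m + 1 ∨ w = (m + 2).choose 2 →
      (w : ℝ) * Real.log w = b * (w - 1 : ℕ) + c * (w - (m + 1) : ℕ)) :
    ∑ y : Fin (m + 2) → Bool, (wt (List.replicate m false) (List.ofFn y) : ℝ) *
        Real.log (wt (List.replicate m false) (List.ofFn y)) =
      b * excess 1 (m + 2) (List.replicate m false) +
        c * excess (m + 1) (m + 2) (List.replicate m false) := by
  simp only [excess, Nat.cast_sum, Finset.mul_sum, ← Finset.sum_add_distrib]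
  refine Finset.sum_congr rfl fun y _ => h _ ?_
  rw [wt_replicate]
  have hle : (List.ofFn y).count false ≤ m + 2 := by
    simpa using List.count_le_length (a := false) (l := List.ofFn y)
  obtain hlt | heq | heq | heq : (List.ofFn y).count false < m ∨ (List.ofFn y).count false = m ∨
      (List.ofFn y).count false = m + 1 ∨ (List.ofFn y).count false = m + 2 := by omega
  · exact Or.inl (Nat.choose_eq_zero_of_lt hlt)
  · rw [heq]
    simp
  · rw [heq]
    simp
  · rw [heq, Nat.choose_symm_of_eq_add (n := m + 2) (a := m) (b := 2) rfl]
    simp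

/-- For a double deletion (`m = n - 2`), the constant string minimizes the entropy:
`H_n(x) ≥ H_n(0^m)`, with equality only if `x ∈ {0^m, 1^m}`. -/
theorem entropy_min_double_deletion (n m : ℕ) (hn : 3 ≤ n) (hm : m = n - 2)
    (x : List Bool) (hx : x.length = m) :
    Hent n (List.replicate m false) ≤ Hent n x ∧
      (Hent n x = Hent n (List.replicate m false) →
        x = List.replicate m false ∨ x = List.replicate m true) := by
  obtain rfl : n = m + 2 := by omega
  have hm1 : 1 ≤ m := by omega
  have hKM : m + 1 < (m + 2).choose 2 := by
    have := Nat.choose_pos (n := m + 1) (k := 2) (by omega)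
    rw [choose_add_two_two]
    omega
  obtain ⟨b, c, hc, hle, heq⟩ := exists_interpolation (K := m + 1) (by omega) hKM
  have hF := sum_mul_log_le x hx hle
  have hF₀ := sum_mul_log_replicate heq
  have hlen : x.length = (List.replicate m false).length := by simpa using hx
  rw [excess_one_eq_of_length_eq (m + 2) hlen] at hF
  have hS₀ : ((m + 1).choose 2 : ℝ) ≤ excess (m + 1) (m + 2) (List.replicate m false) := by
    exact_mod_cast choose_le_excess_replicate m
  have hS : (excess (m + 1) (m + 2) x : ℝ) ≤ (m + 1).choose 2 := by
    have := excess_le x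
    rw [hx] at this
    exact_mod_cast this
  have hμ : (0 : ℝ) < ((m + 2).choose m * 2 ^ (m + 2 - m) : ℕ) * Real.log 2 :=
    mul_pos (Nat.cast_pos.2 (mul_pos (Nat.choose_pos (by omega)) (by positivity)))
      (Real.log_pos one_lt_two)
  rw [Hent_eq _ x (by omega), Hent_eq _ (List.replicate m false) (by simp),
    sum_wt_eq_of_length_eq (m + 2) hlen, hx, List.length_replicate]
  constructor
  · refine div_le_div_of_nonneg_right ?_ hμ.le
    have := mul_le_mul_of_nonneg_left (hS.trans hS₀) hc.le
    linarith
  · intro h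
    rw [div_left_inj' hμ.ne', sub_right_inj] at h
    by_contra hne
    push Not at hne
    have hlt := excess_lt x (by rw [hx]; rintro (_ | _); exacts [hne.1, hne.2])
    rw [hx] at hlt
    have hlt' : (excess (m + 1) (m + 2) x : ℝ) < (m + 1).choose 2 := by exact_mod_cast hlt
    have := mul_lt_mul_of_pos_left (hlt'.trans_le hS₀) hc
    linarith
end
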